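/- arXiv:math-ph/0503075 — 3 statements merged into one kernel-verified Lean document; each statement's English description precedes it below -/
import Mathlib

section
/- Let n ≥ 1, let P be an n×n complex Hermitian matrix with P² = P (an orthogonal projection), and let Q be an n×n Hermitian matrix satisfying −P ≤ Q ≤ I − P in the Loewner order. Then Q² ≤ (I − P) Q (I − P) − P Q P in the Loewner order. -/
open Matrix
open scoped ComplexOrder

theorem Matrix.PosSemidef.sub_mul_self {n : ℕ} {G : Matrix (Fin n) (Fin n) ℂ}
    (h0 : G.PosSemidef) (h1 : (1 - G).PosSemidef) : (G - G * G).PosSemidef := by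
  have ha := h1.conjTranspose_mul_mul_same G
  have hb := h0.conjTranspose_mul_mul_same (1 - G)
  rw [h0.isHermitian.eq] at ha
  rw [h1.isHermitian.eq] at hb
  convert ha.add hb using 1
  noncomm_ring

/-- If `P` is a Hermitian projection and `Q` is Hermitian with
`−P ≤ Q ≤ I − P` in the Loewner order, then `Q² ≤ (I−P)Q(I−P) − PQP`. -/
theorem key_operator_inequality {n : ℕ} (hn : 1 ≤ n)
    (P Q : Matrix (Fin n) (Fin n) ℂ)
    (hP : P.IsHermitian) (hPproj : P * P = P) (hQ : Q.IsHermitian)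
    (hlow : (Q + P).PosSemidef) (hup : ((1 - P) - Q).PosSemidef) :
    ((1 - P) * Q * (1 - P) - P * Q * P - Q * Q).PosSemidef := by
  have h1 : (1 - (Q + P)).PosSemidef := by
    rwa [add_comm, ← sub_sub]
  convert hlow.sub_mul_self h1 using 1
  simp only [add_mul, mul_add, sub_mul, mul_sub, one_mul, mul_one, hPproj]
  abel
end

section
/- Divergence of the self-consistent mass in the ultraviolet cut-off: let Λ > 0, m₀ > 0, α ≥ 0, and let g₀, g₁ : [0,Λ] → ℝ be measurable functions satisfying g₀(r) ≥ m₀ and g₁(r) ≥ 0 and m₀ g₁(r) ≤ r g₀(r) for all r ∈ [0,Λ], together with the self-consistent relation g₀(0) = m₀ + (α/(4π²)) ∫_{B(0,Λ)} g₀(|q|) / ( |q|² √(g₁(|q|)² + g₀(|q|)²) ) dq. Then g₀(0) ≥ m₀ (1 + (α/π) arcsinh(Λ/m₀)). -/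
open MeasureTheory Metric
open scoped Real

noncomputable section

abbrev R3 := EuclideanSpace ℝ (Fin 3)

/-- Integration in polar coordinates of a radial function with a `‖q‖⁻²` singularity
over a ball of `ℝ³`. -/
lemma setIntegral_ball_radial_div_sq (Λ : ℝ) (u v : ℝ → ℝ) :
    ∫ q in Metric.ball (0 : R3) Λ, u ‖q‖ / (‖q‖ ^ 2 * v ‖q‖) =
      4 * π * ∫ y in Set.Ioo 0 Λ, u y / v y := by
  have hball : ∫ q in Metric.ball (0 : R3) Λ, u ‖q‖ / (‖q‖ ^ 2 * v ‖q‖) =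
      ∫ q : R3, (Set.Iio Λ).indicator (fun y => u y / (y ^ 2 * v y)) ‖q‖ := by
    rw [← integral_indicator measurableSet_ball]
    congr 1
    ext q
    simp [Set.indicator]
  have hradial : ∫ y in Set.Ioi (0 : ℝ),
      y ^ 2 * (Set.Iio Λ).indicator (fun y => u y / (y ^ 2 * v y)) y =
      ∫ y in Set.Ioi (0 : ℝ), (Set.Iio Λ).indicator (fun y => u y / v y) y := by
    refine setIntegral_congr_fun measurableSet_Ioi fun y hy => ?_
    have hy' : y ≠ 0 := (Set.mem_Ioi.1 hy).ne'
    by_cases h : y < Λ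
    · simp only [Set.indicator, Set.mem_Iio, h, if_true]
      rw [← mul_div_assoc, mul_div_mul_left _ _ (pow_ne_zero 2 hy')]
    · simp [Set.indicator, h]
  have hvol : (volume : Measure R3).real (ball 0 1) = π * 4 / 3 := by
    rw [Measure.real, EuclideanSpace.volume_ball_fin_three]
    simp only [ENNReal.ofReal_one, one_pow, one_mul]
    exact ENNReal.toReal_ofReal (by positivity)
  rw [hball, integral_fun_norm_addHaar, finrank_euclideanSpace_fin, hvol]
  simp only [smul_eq_mul, nsmul_eq_mul, Nat.add_one_sub_one]
  rw [hradial, setIntegral_indicator measurableSet_Iio, Set.Ioi_inter_Iio]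
  push_cast
  ring

lemma hasDerivAt_mul_arsinh_div {m : ℝ} (hm : m ≠ 0) (y : ℝ) :
    HasDerivAt (fun y => m * Real.arsinh (y / m)) (√(1 + (y / m) ^ 2))⁻¹ y := by
  refine (((hasDerivAt_id y).div_const m).arsinh.const_mul m).congr_deriv ?_
  simp only [smul_eq_mul, id]
  field_simp

lemma continuous_inv_sqrt_one_add_div_sq (m : ℝ) :
    Continuous fun y : ℝ => (√(1 + (y / m) ^ 2))⁻¹ :=
  Continuous.inv₀ (by fun_prop) fun y => by positivity

lemma setIntegral_inv_sqrt_one_add_div_sq {m Λ : ℝ} (hm : m ≠ 0) (hΛ : 0 ≤ Λ) :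
    ∫ y in Set.Ioo 0 Λ, (√(1 + (y / m) ^ 2))⁻¹ = m * Real.arsinh (Λ / m) := by
  rw [← integral_Ioc_eq_integral_Ioo, ← intervalIntegral.integral_of_le hΛ,
    intervalIntegral.integral_eq_sub_of_hasDerivAt
      (fun y _ => hasDerivAt_mul_arsinh_div hm y)
      ((continuous_inv_sqrt_one_add_div_sq m).intervalIntegrable _ _)]
  simp

lemma inv_sqrt_le_div_sqrt {m r a b : ℝ} (hm : 0 < m) (ha : 0 ≤ a) (hb : 0 < b)
    (h : m * a ≤ r * b) : (√(1 + (r / m) ^ 2))⁻¹ ≤ b / √(a ^ 2 + b ^ 2) := by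
  have hab : a ≤ b * (r / m) := by
    rw [← mul_div_assoc, le_div_iff₀ hm]
    linarith
  rw [inv_eq_one_div, div_le_div_iff₀ (by positivity) (by positivity), one_mul,
    Real.sqrt_le_left (by positivity), mul_pow, Real.sq_sqrt (by positivity)]
  nlinarith [pow_le_pow_left₀ ha hab 2]

lemma abs_div_sqrt_sq_add_sq_le_one (a b : ℝ) : |b / √(a ^ 2 + b ^ 2)| ≤ 1 := by
  rw [abs_div, abs_of_nonneg (Real.sqrt_nonneg _)]
  exact div_le_one_of_le₀ (Real.abs_le_sqrt (by nlinarith [sq_nonneg a])) (Real.sqrt_nonneg _)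

/-- Divergence of the self-consistent mass in the ultraviolet cut-off:
if `g₀ ≥ m₀`, `g₁ ≥ 0`, `m₀g₁(r) ≤ r g₀(r)` on `[0,Λ]` and
`g₀(0) = m₀ + (α/(4π²)) ∫_{B(0,Λ)} g₀(|q|)/(|q|²√(g₁(|q|)² + g₀(|q|)²)) dq`,
then `g₀(0) ≥ m₀(1 + (α/π) arcsinh(Λ/m₀))`. -/
theorem mass_divergence (Λ m0 α : ℝ) (hΛ : 0 < Λ) (hm0 : 0 < m0) (hα : 0 ≤ α)
    (g0 g1 : ℝ → ℝ) (hg0m : Measurable g0) (hg1m : Measurable g1)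
    (hg0 : ∀ r ∈ Set.Icc (0 : ℝ) Λ, m0 ≤ g0 r)
    (hg1 : ∀ r ∈ Set.Icc (0 : ℝ) Λ, 0 ≤ g1 r)
    (hg01 : ∀ r ∈ Set.Icc (0 : ℝ) Λ, m0 * g1 r ≤ r * g0 r)
    (heq : g0 0 = m0 + α / (4 * π ^ 2) *
      ∫ q in Metric.ball (0 : R3) Λ,
        g0 ‖q‖ / (‖q‖ ^ 2 * Real.sqrt (g1 ‖q‖ ^ 2 + g0 ‖q‖ ^ 2))) :
    m0 * (1 + α / π * Real.arsinh (Λ / m0)) ≤ g0 0 := by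
  rw [setIntegral_ball_radial_div_sq Λ g0 fun r => √(g1 r ^ 2 + g0 r ^ 2)] at heq
  have hint : IntegrableOn (fun y => g0 y / √(g1 y ^ 2 + g0 y ^ 2)) (Set.Ioo 0 Λ) :=
    Integrable.of_bound (C := 1) (Measurable.aestronglyMeasurable (by fun_prop))
      (ae_of_all _ fun y => abs_div_sqrt_sq_add_sq_le_one (g1 y) (g0 y))
  have hle : m0 * Real.arsinh (Λ / m0) ≤
      ∫ y in Set.Ioo 0 Λ, g0 y / √(g1 y ^ 2 + g0 y ^ 2) := by
    rw [← setIntegral_inv_sqrt_one_add_div_sq hm0.ne' hΛ.le]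
    refine setIntegral_mono_on
      (((continuous_inv_sqrt_one_add_div_sq m0).integrableOn_Icc).mono_set
        Set.Ioo_subset_Icc_self) hint measurableSet_Ioo fun y hy => ?_
    have hy' := Set.Ioo_subset_Icc_self hy
    exact inv_sqrt_le_div_sqrt hm0 (hg1 y hy') (hm0.trans_le (hg0 y hy')) (hg01 y hy')
  calc m0 * (1 + α / π * Real.arsinh (Λ / m0))
      = m0 + α / π * (m0 * Real.arsinh (Λ / m0)) := by ring
    _ ≤ m0 + α / π * ∫ y in Set.Ioo 0 Λ, g0 y / √(g1 y ^ 2 + g0 y ^ 2) := by gcongr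
    _ = g0 0 := by
      rw [heq]
      field_simp

end
end

section
/- Commutator bound for Fourier multipliers against trigonometric multiplication operators: let Γ ⊂ ℝ³ be a finite set, let H be the Hilbert space of functions Γ → ℂ⁴ with the ℓ² inner product, let A : Γ → M₄(ℂ) and let c : ℝ³ → ℂ be a finitely supported function. Define the operators 𝔄 and T on H by (𝔄u)(k) = A(k)u(k) and (Tu)(k) = Σ_{l∈Γ} c(k−l) u(l). If there is a constant C ≥ 0 with ‖A(k) − A(l)‖ ≤ C|k−l| for all k, l ∈ Γ (operator norm on M₄(ℂ), Euclidean norm on ℝ³), then the operator norm of the commutator satisfies ‖𝔄T − T𝔄‖ ≤ C Σ_{j∈ℝ³} |c(j)| |j| (the sum running over the finite support of c). -/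
open Matrix

noncomputable section

abbrev M4 := Matrix (Fin 4) (Fin 4) ℂ

/-- The Euclidean (ℓ²) norm of a vector in `ℂ⁴`. -/
def vecNorm (v : Fin 4 → ℂ) : ℝ := Real.sqrt (∑ i, ‖v i‖ ^ 2)

theorem vecNorm_eq_norm_toLp (v : Fin 4 → ℂ) : vecNorm v = ‖WithLp.toLp 2 v‖ := by
  rw [EuclideanSpace.norm_eq, vecNorm]

theorem vecNorm_sq (v : Fin 4 → ℂ) : vecNorm v ^ 2 = ∑ i, ‖v i‖ ^ 2 :=
  Real.sq_sqrt (by positivity)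

theorem vecNorm_nonneg (v : Fin 4 → ℂ) : 0 ≤ vecNorm v := Real.sqrt_nonneg _

theorem vecNorm_smul (a : ℂ) (v : Fin 4 → ℂ) : vecNorm (a • v) = ‖a‖ * vecNorm v := by
  rw [vecNorm_eq_norm_toLp, vecNorm_eq_norm_toLp, WithLp.toLp_smul, norm_smul]

theorem vecNorm_sum_le {ι : Type*} (s : Finset ι) (f : ι → Fin 4 → ℂ) :
    vecNorm (∑ l ∈ s, f l) ≤ ∑ l ∈ s, vecNorm (f l) := by
  simp only [vecNorm_eq_norm_toLp, WithLp.toLp_sum]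
  exact norm_sum_le _ _

theorem sum_le_finsum_of_nonneg {α : Type*} {f : α → ℝ} (hf : ∀ x, 0 ≤ f x)
    (hfin : (Function.support f).Finite) (s : Finset α) : ∑ x ∈ s, f x ≤ ∑ᶠ x, f x := by
  classical
  rw [finsum_eq_sum_of_support_subset f (s := s ∪ hfin.toFinset) (by simp)]
  exact Finset.sum_le_sum_of_subset_of_nonneg Finset.subset_union_left fun x _ _ => hf x

theorem sum_comp_le_finsum_of_nonneg {α β : Type*} {f : α → ℝ} (hf : ∀ x, 0 ≤ f x)
    (hfin : (Function.support f).Finite) (s : Finset β) {g : β → α} (hg : g.Injective) :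
    ∑ y ∈ s, f (g y) ≤ ∑ᶠ x, f x := by
  simpa using sum_le_finsum_of_nonneg hf hfin (s.map ⟨g, hg⟩)

/-- The Schur test for a finite nonnegative kernel with row and column sums at most `S`. -/
theorem schur_test {α : Type*} (s : Finset α) (K : α → α → ℝ) (x : α → ℝ) {S : ℝ} (hS : 0 ≤ S)
    (hK : ∀ k l, 0 ≤ K k l) (hrow : ∀ k, ∑ l ∈ s, K k l ≤ S) (hcol : ∀ l, ∑ k ∈ s, K k l ≤ S) :
    ∑ k ∈ s, (∑ l ∈ s, K k l * x l) ^ 2 ≤ S ^ 2 * ∑ l ∈ s, x l ^ 2 :=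
  calc ∑ k ∈ s, (∑ l ∈ s, K k l * x l) ^ 2
      ≤ ∑ k ∈ s, S * ∑ l ∈ s, K k l * x l ^ 2 := by
        refine Finset.sum_le_sum fun k _ => ?_
        have hnn : ∀ l ∈ s, 0 ≤ K k l * x l ^ 2 := fun l _ => mul_nonneg (hK k l) (sq_nonneg _)
        exact (Finset.sum_sq_le_sum_mul_sum_of_sq_le_mul s (fun l _ => hK k l) hnn
          fun l _ => (by ring : (K k l * x l) ^ 2 = K k l * (K k l * x l ^ 2)).le).trans
            (mul_le_mul_of_nonneg_right (hrow k) (Finset.sum_nonneg hnn))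
    _ = S * ∑ l ∈ s, (∑ k ∈ s, K k l) * x l ^ 2 := by
        rw [← Finset.mul_sum, Finset.sum_comm]
        simp_rw [Finset.sum_mul]
    _ ≤ S * ∑ l ∈ s, S * x l ^ 2 := by
        gcongr with l _
        exact hcol l
    _ = S ^ 2 * ∑ l ∈ s, x l ^ 2 := by
        rw [← Finset.mul_sum]
        ring

/-- Commutator bound for Fourier multipliers against trigonometric
multiplication operators: on `H = ℓ²(Γ; ℂ⁴)` (`Γ ⊂ ℝ³` finite), let `(𝔄u)(k) = A(k)u(k)`
and `(Tu)(k) = Σ_{l∈Γ} c(k−l)u(l)` with `c` finitely supported. If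
`‖A(k) − A(l)‖ ≤ C|k−l|` (operator norm) for `k, l ∈ Γ`, then
`‖𝔄T − T𝔄‖ ≤ C Σ_j |c(j)||j|`, i.e. `‖(𝔄T − T𝔄)u‖ ≤ C (Σ_j |c(j)||j|) ‖u‖` for all `u`. -/
theorem commutator_bound (Γ : Finset R3) (A : R3 → M4) (c : R3 → ℂ)
    (hc : (Function.support c).Finite) (C : ℝ) (hC : 0 ≤ C)
    (hA : ∀ k ∈ Γ, ∀ l ∈ Γ, ∀ v : Fin 4 → ℂ,
      vecNorm ((A k - A l) *ᵥ v) ≤ C * ‖k - l‖ * vecNorm v) :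
    ∀ u : R3 → Fin 4 → ℂ,
      Real.sqrt (∑ k ∈ Γ, ∑ i,
          ‖(A k *ᵥ (∑ l ∈ Γ, c (k - l) • u l)
            - ∑ l ∈ Γ, c (k - l) • (A l *ᵥ u l)) i‖ ^ 2)
        ≤ C * (∑ᶠ j, ‖c j‖ * ‖j‖) *
            Real.sqrt (∑ k ∈ Γ, ∑ i, ‖u k i‖ ^ 2) := by
  intro u
  set b : R3 → ℝ := fun j => ‖c j‖ * ‖j‖ with hb
  have hb0 : ∀ j, 0 ≤ b j := fun j => by positivity
  have hbfin : (Function.support b).Finite := hc.subset fun j hj hcj => hj (by simp [hb, hcj])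
  have hS : 0 ≤ C * ∑ᶠ j, b j := mul_nonneg hC (finsum_nonneg hb0)
  have hkernel : ∀ k ∈ Γ, vecNorm (A k *ᵥ (∑ l ∈ Γ, c (k - l) • u l)
      - ∑ l ∈ Γ, c (k - l) • (A l *ᵥ u l)) ≤ ∑ l ∈ Γ, C * b (k - l) * vecNorm (u l) := by
    intro k hk
    have hcomm : A k *ᵥ (∑ l ∈ Γ, c (k - l) • u l) - ∑ l ∈ Γ, c (k - l) • (A l *ᵥ u l)
        = ∑ l ∈ Γ, c (k - l) • ((A k - A l) *ᵥ u l) := by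
      simp only [Matrix.mulVec_sum, Matrix.mulVec_smul, Matrix.sub_mulVec, smul_sub,
        Finset.sum_sub_distrib]
    rw [hcomm]
    refine (vecNorm_sum_le _ _).trans (Finset.sum_le_sum fun l hl => ?_)
    rw [vecNorm_smul]
    calc ‖c (k - l)‖ * vecNorm ((A k - A l) *ᵥ u l)
        ≤ ‖c (k - l)‖ * (C * ‖k - l‖ * vecNorm (u l)) := by
          gcongr
          exact hA k hk l hl _
      _ = C * b (k - l) * vecNorm (u l) := by
          simp only [hb]
          ring
  simp only [← vecNorm_sq]
  refine Real.sqrt_le_iff.mpr ⟨mul_nonneg hS (Real.sqrt_nonneg _), ?_⟩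
  rw [mul_pow, Real.sq_sqrt (by positivity)]
  refine (Finset.sum_le_sum fun k hk =>
    pow_le_pow_left₀ (vecNorm_nonneg _) (hkernel k hk) 2).trans ?_
  refine schur_test Γ (fun k l => C * b (k - l)) _ hS
    (fun k l => mul_nonneg hC (hb0 _)) (fun k => ?_) fun l => ?_
  · rw [← Finset.mul_sum]
    exact mul_le_mul_of_nonneg_left
      (sum_comp_le_finsum_of_nonneg hb0 hbfin Γ sub_right_injective) hC
  · rw [← Finset.mul_sum]
    exact mul_le_mul_of_nonneg_left
      (sum_comp_le_finsum_of_nonneg hb0 hbfin Γ sub_left_injective) hC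

end
end
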